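/- Let G be a finite simple graph with clique number w ≥ 1, and let β = β(G). Then for every j with 1 ≤ j ≤ w, the alternating partial sum β^j − c_1(G) β^{j−1} + c_2(G) β^{j−2} − … + (−1)^j c_j(G) is ≤ 0 when j is odd and ≥ 0 when j is even. -/

import Mathlib

noncomputable section

/-- The number of cliques of size `k` in `G` (the empty set is the unique clique of size 0). -/
def cliqueCount {V : Type*} [Fintype V] (G : SimpleGraph V) (k : ℕ) : ℕ :=
  Nat.card {s : Finset V // G.IsNClique k s}

/-- The clique number `ω(G)` of `G`. -/
def cliqueNum {V : Type*} [Fintype V] (G : SimpleGraph V) : ℕ :=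
  sSup {k : ℕ | ∃ s : Finset V, G.IsNClique k s}

/-- The PC-polynomial `PC(G,x) = ∑_{k=0}^{ω(G)} (-1)^k c_k(G) x^{ω(G)-k}`. -/
def PCpoly {V : Type*} [Fintype V] (G : SimpleGraph V) : Polynomial ℝ :=
  ∑ k ∈ Finset.range (cliqueNum G + 1),
    Polynomial.C ((-1 : ℝ) ^ k * (cliqueCount G k : ℝ)) * Polynomial.X ^ (cliqueNum G - k)

/-- `β(G)`, the largest real root of the PC-polynomial of `G`. -/
def beta {V : Type*} [Fintype V] (G : SimpleGraph V) : ℝ :=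
  sSup {x : ℝ | (PCpoly G).eval x = 0}

open Classical in
/-- The sum of `f |s|` over the cliques `s` of `G` contained in `H`. -/
def cliqueSum {V : Type*} (G : SimpleGraph V) (f : ℕ → ℝ) (H : Finset V) : ℝ :=
  ∑ s ∈ H.powerset.filter fun s : Finset V => G.IsClique (s : Set V), f s.card

/-- The part of the clique polynomial `∑ (-t) ^ |s|` of `G[H]` given by cliques of size at
least `j`. -/
def cliqueTail {V : Type*} (G : SimpleGraph V) (j : ℕ) (H : Finset V) (t : ℝ) : ℝ :=
  cliqueSum G (fun k => if j ≤ k then (-t) ^ k else 0) H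

section

variable {V : Type*} (G : SimpleGraph V)

theorem cliqueSum_empty (f : ℕ → ℝ) : cliqueSum G f ∅ = f 0 := by
  simp [cliqueSum, Finset.sum_filter]

open Classical in
theorem cliqueSum_insert (f : ℕ → ℝ) {v : V} {H : Finset V} (hv : v ∉ H) :
    cliqueSum G f (insert v H) =
      cliqueSum G f H + cliqueSum G (fun k => f (k + 1)) (H.filter (G.Adj v)) := by
  unfold cliqueSum
  rw [Finset.sum_filter, Finset.sum_powerset_insert hv, ← Finset.sum_filter, ← Finset.sum_filter]
  congr 1
  have hset : (H.powerset.filter fun s => G.IsClique ((insert v s : Finset V) : Set V)) =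
      (H.filter (G.Adj v)).powerset.filter fun s : Finset V => G.IsClique (s : Set V) := by
    ext s
    simp only [Finset.mem_filter, Finset.mem_powerset, Finset.coe_insert]
    constructor
    · rintro ⟨hs, hc⟩
      have hvs : v ∉ (s : Set V) := fun h => hv (hs h)
      rw [SimpleGraph.isClique_insert_of_notMem hvs] at hc
      exact ⟨fun x hx => Finset.mem_filter.2 ⟨hs hx, hc.2 x hx⟩, hc.1⟩
    · rintro ⟨hs, hc⟩
      refine ⟨fun x hx => (Finset.mem_filter.1 (hs hx)).1, ?_⟩
      exact hc.insert fun x hx _ => (Finset.mem_filter.1 (hs hx)).2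
  rw [hset]
  refine Finset.sum_congr rfl fun s hs => ?_
  rw [Finset.card_insert_of_notMem]
  intro hvs
  have := (Finset.mem_powerset.1 (Finset.mem_filter.1 hs).1) hvs
  exact hv (Finset.mem_filter.1 this).1

theorem cliqueSum_const_mul (c : ℝ) (f : ℕ → ℝ) (H : Finset V) :
    cliqueSum G (fun k => c * f k) H = c * cliqueSum G f H := by
  simp [cliqueSum, Finset.mul_sum]

open Classical in
theorem cliqueTail_insert (j : ℕ) (t : ℝ) {v : V} {H : Finset V} (hv : v ∉ H) :
    cliqueTail G j (insert v H) t =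
      cliqueTail G j H t - t * cliqueTail G (j - 1) (H.filter (G.Adj v)) t := by
  have h : (fun k => if j ≤ k + 1 then (-t) ^ (k + 1) else 0) =
      fun k => (-t) * (if j - 1 ≤ k then (-t) ^ k else 0) := by
    funext k
    simp only [Nat.sub_le_iff_le_add, pow_succ']
    split_ifs <;> simp
  unfold cliqueTail
  rw [cliqueSum_insert G _ hv, h, cliqueSum_const_mul]
  ring

theorem cliqueTail_zero_empty (t : ℝ) : cliqueTail G 0 ∅ t = 1 := by
  simp [cliqueTail, cliqueSum_empty]

theorem cliqueTail_zero_apply_zero (H : Finset V) : cliqueTail G 0 H 0 = 1 := by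
  classical
  induction H using Finset.induction_on with
  | empty => exact cliqueTail_zero_empty G 0
  | insert v H hv ih => rw [cliqueTail_insert G 0 0 hv, ih]; simp

theorem continuous_cliqueTail (H : Finset V) : Continuous (cliqueTail G 0 H) := by
  unfold cliqueTail cliqueSum
  simp only [zero_le, if_true]
  fun_prop

theorem cliqueTail_zero_nonneg_of_pos {r : ℝ} (hr : 0 < r) {H : Finset V}
    (hH : ∀ t ∈ Set.Ico 0 r, 0 < cliqueTail G 0 H t) : 0 ≤ cliqueTail G 0 H r := by
  have hcl : Set.Icc 0 r ⊆ {t | 0 ≤ cliqueTail G 0 H t} := by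
    rw [← closure_Ico hr.ne]
    exact closure_minimal (fun t ht => (hH t ht).le)
      (isClosed_le continuous_const (continuous_cliqueTail G H))
  exact hcl ⟨hr.le, le_rfl⟩

/-- If the clique polynomial of `G[H]` is positive on `[0, r)`, then so is that of every induced
subgraph. -/
theorem cliqueTail_zero_pos_of_subset {r : ℝ} {H K : Finset V} (hKH : K ⊆ H)
    (hH : ∀ t ∈ Set.Ico 0 r, 0 < cliqueTail G 0 H t) :
    ∀ t ∈ Set.Ico 0 r, 0 < cliqueTail G 0 K t := by
  classical
  induction H using Finset.strongInduction generalizing K r with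
  | H H₀ ih =>
    by_cases hK : K = H₀
    · rwa [hK]
    obtain ⟨v, hvH, hvK⟩ := Finset.exists_of_ssubset (hKH.ssubset_of_ne hK)
    obtain ⟨H, hv, rfl⟩ : ∃ H, v ∉ H ∧ insert v H = H₀ :=
      ⟨H₀.erase v, Finset.notMem_erase v H₀, Finset.insert_erase hvH⟩
    replace ih {r : ℝ} {K : Finset V} := @ih H (Finset.ssubset_insert hv) r K
    have hpos : ∀ t ∈ Set.Ico 0 r, 0 < cliqueTail G 0 H t := by
      by_contra! hneg
      obtain ⟨u, hu, hu0⟩ := hneg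
      have hcpt : IsCompact (Set.Icc 0 u ∩ {t | cliqueTail G 0 H t ≤ 0}) :=
        isCompact_Icc.inter_right (isClosed_le (continuous_cliqueTail G H) continuous_const)
      obtain ⟨s, ⟨hs, hs0⟩, hmin⟩ := hcpt.exists_isLeast ⟨u, ⟨hu.1, le_rfl⟩, hu0⟩
      have hbefore : ∀ t ∈ Set.Ico 0 s, 0 < cliqueTail G 0 H t := by
        intro t ht
        by_contra! hle
        exact ht.2.not_ge (hmin ⟨⟨ht.1, ht.2.le.trans hs.2⟩, hle⟩)
      have hspos : 0 < s := by
        refine hs.1.lt_of_ne fun h => ?_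
        simp only [Set.mem_ofPred_eq, ← h, cliqueTail_zero_apply_zero] at hs0
        linarith
      have hN : 0 ≤ cliqueTail G 0 (H.filter (G.Adj v)) s :=
        cliqueTail_zero_nonneg_of_pos G hspos (ih (Finset.filter_subset _ _) hbefore)
      have := hH s ⟨hs.1, hs.2.trans_lt hu.2⟩
      rw [cliqueTail_insert G 0 s hv] at this
      have hs0' : cliqueTail G 0 H s ≤ 0 := hs0
      have := mul_nonneg hs.1 hN
      simp only [Nat.zero_sub] at *
      linarith
    exact ih ((Finset.subset_insert_iff_of_notMem hvK).1 hKH) hpos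

theorem cliqueTail_sign {t : ℝ} (ht : 0 ≤ t) {H : Finset V}
    (hH : ∀ K ⊆ H, 0 ≤ cliqueTail G 0 K t) (j : ℕ) :
    0 ≤ (-1) ^ j * cliqueTail G j H t := by
  classical
  induction H using Finset.strongInduction generalizing j with
  | H H₀ ih =>
    rcases j with _ | j
    · simpa using hH H₀ subset_rfl
    rcases H₀.eq_empty_or_nonempty with rfl | ⟨v, hvH⟩
    · simp [cliqueTail, cliqueSum_empty]
    obtain ⟨H, hv, rfl⟩ : ∃ H, v ∉ H ∧ insert v H = H₀ :=
      ⟨H₀.erase v, Finset.notMem_erase v H₀, Finset.insert_erase hvH⟩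
    have hsub : H ⊂ insert v H := Finset.ssubset_insert hv
    have hN : H.filter (G.Adj v) ⊂ insert v H := (Finset.filter_subset _ _).trans_ssubset hsub
    have h1 := ih H hsub (fun K hK => hH K (hK.trans hsub.subset)) (j + 1)
    have h2 := mul_nonneg ht (ih _ hN (fun K hK => hH K (hK.trans hN.subset)) j)
    rw [cliqueTail_insert G (j + 1) t hv, Nat.add_sub_cancel]
    rw [pow_succ] at *
    linarith

theorem exists_cliqueTail_zero_eq_zero {H : Finset V} (hne : H.Nonempty) :
    ∃ t, 0 < t ∧ cliqueTail G 0 H t = 0 := by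
  classical
  obtain ⟨v, hv⟩ := hne
  obtain ⟨u, hu, hu0⟩ : ∃ u ∈ Set.Ico (0 : ℝ) 2, cliqueTail G 0 H u ≤ 0 := by
    by_contra! h
    have h1 := cliqueTail_zero_pos_of_subset G (Finset.singleton_subset_iff.2 hv) h 1 (by norm_num)
    rw [← insert_empty_eq, cliqueTail_insert G 0 1 (Finset.notMem_empty v)] at h1
    simp [cliqueTail_zero_empty] at h1
  obtain ⟨t, ht, ht0⟩ := intermediate_value_Icc' hu.1 (continuous_cliqueTail G H).continuousOn
    ⟨hu0, by rw [cliqueTail_zero_apply_zero]; exact zero_le_one⟩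
  refine ⟨t, ht.1.lt_of_ne fun h => ?_, ht0⟩
  rw [← h, cliqueTail_zero_apply_zero] at ht0
  exact one_ne_zero ht0

variable [Fintype V]

open Classical in
theorem cliqueCount_eq_card_filter (k : ℕ) :
    cliqueCount G k = (Finset.univ.filter fun s : Finset V => G.IsNClique k s).card := by
  rw [cliqueCount, Nat.card_eq_fintype_card, Fintype.card_subtype]

theorem bddAbove_cliqueSizes : BddAbove {k : ℕ | ∃ s : Finset V, G.IsNClique k s} :=
  ⟨Fintype.card V, by rintro k ⟨s, hs⟩; exact hs.card_eq ▸ s.card_le_univ⟩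

/-- An alternating partial sum of clique counts, expressed through the clique polynomial. -/
theorem alternating_sum_eq (m : ℕ) {x : ℝ} (hx : x ≠ 0) :
    ∑ i ∈ Finset.range (m + 1), (-1 : ℝ) ^ i * (cliqueCount G i : ℝ) * x ^ (m - i) =
      x ^ m * (cliqueTail G 0 Finset.univ x⁻¹ - cliqueTail G (m + 1) Finset.univ x⁻¹) := by
  classical
  have hsum : cliqueTail G 0 Finset.univ x⁻¹ - cliqueTail G (m + 1) Finset.univ x⁻¹ =
      ∑ s ∈ Finset.univ.filter fun s : Finset V =>
        G.IsClique (s : Set V) ∧ s.card ∈ Finset.range (m + 1), (-x⁻¹) ^ s.card := by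
    unfold cliqueTail cliqueSum
    rw [← Finset.sum_sub_distrib, Finset.powerset_univ, ← Finset.filter_filter,
      Finset.sum_filter (fun s : Finset V => s.card ∈ Finset.range (m + 1))]
    refine Finset.sum_congr (by congr) fun s _ => ?_
    by_cases h : m + 1 ≤ s.card
    · simp [h, Nat.not_le.2 h]
    · simp [h, not_le.1 h]
  rw [hsum, ← Finset.sum_fiberwise_of_maps_to (g := Finset.card) (t := Finset.range (m + 1))
    (fun s hs => (Finset.mem_filter.1 hs).2.2), Finset.mul_sum]
  refine Finset.sum_congr rfl fun i hi => ?_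
  have hfib : ((Finset.univ.filter fun s : Finset V =>
      G.IsClique (s : Set V) ∧ s.card ∈ Finset.range (m + 1)).filter fun s => s.card = i) =
      Finset.univ.filter fun s => G.IsNClique i s := by
    ext s
    simp only [Finset.mem_filter, Finset.mem_univ, true_and, SimpleGraph.isNClique_iff]
    constructor
    · rintro ⟨⟨h, -⟩, hc⟩
      exact ⟨h, hc⟩
    · rintro ⟨h, rfl⟩
      exact ⟨⟨h, hi⟩, rfl⟩
  rw [hfib, Finset.sum_congr rfl (g := fun _ => (-x⁻¹) ^ i), Finset.sum_const, nsmul_eq_mul,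
    cliqueCount_eq_card_filter]
  · have him : i ≤ m := Nat.lt_succ_iff.1 (Finset.mem_range.1 hi)
    rw [pow_sub₀ x hx him, neg_eq_neg_one_mul x⁻¹, mul_pow, inv_pow]
    ring
  · intro s hs
    rw [(Finset.mem_filter.1 hs).2.card_eq]

theorem eval_PCpoly {x : ℝ} (hx : x ≠ 0) :
    (PCpoly G).eval x = x ^ cliqueNum G * cliqueTail G 0 Finset.univ x⁻¹ := by
  have htail : cliqueTail G (cliqueNum G + 1) Finset.univ x⁻¹ = 0 := by
    classical
    refine Finset.sum_eq_zero fun s hs => if_neg ?_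
    rw [not_le, Nat.lt_succ_iff]
    exact le_csSup (bddAbove_cliqueSizes G) ⟨s, ⟨(Finset.mem_filter.1 hs).2, rfl⟩⟩
  have h := alternating_sum_eq G (cliqueNum G) hx
  rw [htail, sub_zero] at h
  rw [← h, PCpoly, Polynomial.eval_finsetSum]
  simp

theorem PCpoly_ne_zero : PCpoly G ≠ 0 := by
  intro h
  have hzero (t : ℝ) (ht : t ≠ 0) : cliqueTail G 0 Finset.univ t = 0 := by
    have h' := eval_PCpoly G (inv_ne_zero ht)
    rw [h, Polynomial.eval_zero, inv_inv] at h'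
    exact (mul_eq_zero.1 h'.symm).resolve_left (pow_ne_zero _ (inv_ne_zero ht))
  have hev := Continuous.ext_on (dense_compl_singleton (0 : ℝ))
    (continuous_cliqueTail G Finset.univ) (continuous_const (y := (0 : ℝ))) hzero
  have := congrFun hev 0
  rw [cliqueTail_zero_apply_zero] at this
  exact one_ne_zero this

theorem finite_roots_PCpoly : {x : ℝ | (PCpoly G).eval x = 0}.Finite :=
  Polynomial.finite_setOfPred_isRoot (PCpoly_ne_zero G)

theorem le_beta {x : ℝ} (hx : (PCpoly G).eval x = 0) : x ≤ beta G :=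
  le_csSup (finite_roots_PCpoly G).bddAbove hx

/-- The inverse of `beta G` is the first positive zero of the clique polynomial of `G`. -/
theorem beta_isFirstZero [Nonempty V] :
    0 < beta G ∧ cliqueTail G 0 Finset.univ (beta G)⁻¹ = 0 ∧
      ∀ t ∈ Set.Ico 0 (beta G)⁻¹, 0 < cliqueTail G 0 Finset.univ t := by
  have hroot {t : ℝ} (ht : 0 < t) (h0 : cliqueTail G 0 Finset.univ t = 0) :
      (PCpoly G).eval t⁻¹ = 0 := by
    rw [eval_PCpoly G (inv_ne_zero ht.ne'), inv_inv, h0, mul_zero]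
  obtain ⟨t₀, ht₀, h0⟩ := exists_cliqueTail_zero_eq_zero G (Finset.univ_nonempty (α := V))
  have hβ : 0 < beta G := (inv_pos.2 ht₀).trans_le (le_beta G (hroot ht₀ h0))
  have hmem : (PCpoly G).eval (beta G) = 0 :=
    Set.Nonempty.csSup_mem (s := {x : ℝ | (PCpoly G).eval x = 0})
      ⟨_, hroot ht₀ h0⟩ (finite_roots_PCpoly G)
  rw [eval_PCpoly G hβ.ne'] at hmem
  refine ⟨hβ, (mul_eq_zero.1 hmem).resolve_left (pow_ne_zero _ hβ.ne'), fun t ht => ?_⟩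
  by_contra! hneg
  obtain ⟨s, hs, hs0⟩ := intermediate_value_Icc' ht.1
    (continuous_cliqueTail G Finset.univ).continuousOn
    ⟨hneg, by rw [cliqueTail_zero_apply_zero]; exact zero_le_one⟩
  have hspos : 0 < s := hs.1.lt_of_ne fun h => by
    rw [← h, cliqueTail_zero_apply_zero] at hs0
    exact one_ne_zero hs0
  have := inv_le_of_inv_le₀ hspos (le_beta G (hroot hspos hs0))
  exact (hs.2.trans_lt ht.2).not_ge this

end

/-- For `1 ≤ j ≤ ω(G)`, the alternating partial sum
`β^j - c_1 β^{j-1} + c_2 β^{j-2} - … + (-1)^j c_j` is `≤ 0` for odd `j`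
and `≥ 0` for even `j`. -/
theorem stmt_5 {V : Type*} [Fintype V] (G : SimpleGraph V) (j : ℕ)
    (hj1 : 1 ≤ j) (hjw : j ≤ cliqueNum G) :
    (Odd j →
      ∑ i ∈ Finset.range (j + 1),
        (-1 : ℝ) ^ i * (cliqueCount G i : ℝ) * (beta G) ^ (j - i) ≤ 0) ∧
    (Even j →
      0 ≤ ∑ i ∈ Finset.range (j + 1),
        (-1 : ℝ) ^ i * (cliqueCount G i : ℝ) * (beta G) ^ (j - i)) := by
  have hV : Nonempty V := by
    by_contra hV
    rw [not_nonempty_iff] at hV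
    have hle : cliqueNum G ≤ 0 := csSup_le' (by
      rintro k ⟨s, hs⟩
      rw [← hs.card_eq, Finset.eq_empty_of_isEmpty s, Finset.card_empty])
    omega
  obtain ⟨hβ, h0, hpos⟩ := beta_isFirstZero G
  have hsign := cliqueTail_sign G (inv_pos.2 hβ).le (H := Finset.univ)
    (fun K hK => cliqueTail_zero_nonneg_of_pos G (inv_pos.2 hβ)
      (cliqueTail_zero_pos_of_subset G hK hpos)) (j + 1)
  rw [alternating_sum_eq G j hβ.ne', h0, zero_sub]
  have hpow : 0 ≤ beta G ^ j := (pow_pos hβ j).le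
  constructor
  · intro hj
    rw [hj.add_one.neg_one_pow, one_mul] at hsign
    exact mul_nonpos_of_nonneg_of_nonpos hpow (neg_nonpos.2 hsign)
  · intro hj
    rw [hj.add_one.neg_one_pow, neg_one_mul] at hsign
    exact mul_nonneg hpow hsign
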